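/- arXiv:1503.04991 — 4 statements merged into one kernel-verified Lean document; each statement's English description precedes it below -/
import Mathlib

section
/- Let P be a Dyck path of semilength n. Then the pseudocomplement ∼P is the unique Dyck path Q of semilength n such that every factor of Q is a pyramid and, for every even integer x with 0 < x < 2n, x is a return of Q if and only if x is not a return of P. -/
/-- A Dyck path of semilength `n`, encoded by its height function:
`h t` is the height after the first `t` steps (number of `u`'s minus number of `d`'s
among the first `t` letters). -/
structure DyckPath (n : ℕ) where
  h : ℕ → ℤ
  init : h 0 = 0
  tail : ∀ t, 2 * n ≤ t → h t = 0
  step : ∀ t, t < 2 * n → h (t + 1) = h t + 1 ∨ h (t + 1) = h t - 1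
  nonneg : ∀ t, 0 ≤ h t

/-- The partial order on Dyck paths: `P ≤ Q` iff the height of `P` is pointwise
at most the height of `Q`. -/
def dle {n : ℕ} (P Q : DyckPath n) : Prop := ∀ t, P.h t ≤ Q.h t

/-- `R` is the relative pseudocomplement `P ⇝ Q` in the Dyck algebra `𝔇_n`:
`R` is the greatest Dyck path such that `P ∧ R ≤ Q` (meet being the pointwise
minimum of height functions). -/
def IsRelPseudo {n : ℕ} (P Q R : DyckPath n) : Prop :=
  (∀ t, min (P.h t) (R.h t) ≤ Q.h t) ∧
  ∀ S : DyckPath n, (∀ t, min (P.h t) (S.h t) ≤ Q.h t) → dle S R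

/-- The height function of the minimum Dyck path `(ud)^n`. -/
def minH (n : ℕ) (t : ℕ) : ℤ := if 2 * n ≤ t then 0 else (t : ℤ) % 2

/-- The minimum Dyck path `(ud)^n` of semilength `n`. -/
def minPath (n : ℕ) : DyckPath n where
  h := minH n
  init := by unfold minH; split_ifs <;> omega
  tail := by intro t ht; unfold minH; split_ifs <;> omega
  step := by intro t ht; unfold minH; split_ifs <;> omega
  nonneg := by intro t; unfold minH; split_ifs <;> omega

/-- `R` is the pseudocomplement `∼P = P ⇝ 0` in the Dyck algebra `𝔇_n`. -/
def IsPseudo {n : ℕ} (P R : DyckPath n) : Prop := IsRelPseudo P (minPath n) R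

/-- `x` is a return of `P`: an even abscissa `2 ≤ x ≤ 2n` where the path touches the `x`-axis. -/
def IsReturn {n : ℕ} (P : DyckPath n) (x : ℕ) : Prop :=
  Even x ∧ 2 ≤ x ∧ x ≤ 2 * n ∧ P.h x = 0

/-- Every factor of `P` (portion between two consecutive points of the path on the
`x`-axis) is a pyramid `u^k d^k`, i.e. between two consecutive zeroes `a < b` of the
height function the height is `min (t - a) (b - t)`. -/
def FactorsArePyramids {n : ℕ} (P : DyckPath n) : Prop :=
  ∀ a b : ℕ, a < b → b ≤ 2 * n → P.h a = 0 → P.h b = 0 →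
    (∀ c, a < c → c < b → 0 < P.h c) →
    ∀ t, a ≤ t → t ≤ b → P.h t = min ((t : ℤ) - (a : ℤ)) ((b : ℤ) - (t : ℤ))

namespace DyckPath

variable {n : ℕ}

theorem ext_height {P Q : DyckPath n} (h : ∀ t, P.h t = Q.h t) : P = Q := by
  cases P
  cases Q
  congr
  exact funext h

theorem height_mod_two (P : DyckPath n) {t : ℕ} (ht : t ≤ 2 * n) :
    P.h t % 2 = (t : ℤ) % 2 := by
  induction t with
  | zero => simp [P.init]
  | succ t ih =>
    have := ih (by omega)
    have := P.step t (by omega)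
    omega

theorem abs_height_succ_sub_le (P : DyckPath n) (t : ℕ) : |P.h (t + 1) - P.h t| ≤ 1 := by
  rw [abs_le]
  by_cases ht : t < 2 * n
  · have := P.step t ht
    omega
  · have := P.tail t (by omega)
    have := P.tail (t + 1) (by omega)
    omega

theorem abs_height_add_sub_le (P : DyckPath n) (s k : ℕ) : |P.h (s + k) - P.h s| ≤ k := by
  induction k with
  | zero => simp
  | succ k ih =>
    have := P.abs_height_succ_sub_le (s + k)
    rw [abs_le] at *
    push_cast [← add_assoc] at *
    omega

theorem height_le_dist_zero (P : DyckPath n) {z : ℕ} (hz : P.h z = 0) (t : ℕ) :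
    P.h t ≤ max ((t : ℤ) - z) ((z : ℤ) - t) := by
  rcases le_total z t with h | h
  · obtain ⟨k, rfl⟩ := Nat.exists_eq_add_of_le h
    have := abs_le.1 (P.abs_height_add_sub_le z k)
    omega
  · obtain ⟨k, rfl⟩ := Nat.exists_eq_add_of_le h
    have := abs_le.1 (P.abs_height_add_sub_le t k)
    omega

/-- The largest Dyck path vanishing on a given set of even abscissae: its height is the distance
to that set. -/
theorem exists_height_eq_dist (Z : Finset ℕ) (h_even : ∀ z ∈ Z, Even z) (h_zero : 0 ∈ Z)
    (h_end : 2 * n ∈ Z) :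
    ∃ M : DyckPath n, (∀ t < 2 * n, ∃ z ∈ Z, M.h t = max ((t : ℤ) - z) ((z : ℤ) - t)) ∧
      ∀ t, ∀ z ∈ Z, M.h t ≤ max ((t : ℤ) - z) ((z : ℤ) - t) := by
  let d (t : ℕ) : ℤ := Z.inf' ⟨0, h_zero⟩ fun z => max ((t : ℤ) - z) ((z : ℤ) - t)
  have d_le (t z : ℕ) (hz : z ∈ Z) : d t ≤ max ((t : ℤ) - z) ((z : ℤ) - t) :=
    Finset.inf'_le _ hz
  have exists_d (t : ℕ) : ∃ z ∈ Z, d t = max ((t : ℤ) - z) ((z : ℤ) - t) :=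
    Finset.exists_mem_eq_inf' _ _
  have d_nonneg (t : ℕ) : 0 ≤ d t := by
    obtain ⟨z, -, hz⟩ := exists_d t
    omega
  have d_step (t : ℕ) : d (t + 1) = d t + 1 ∨ d (t + 1) = d t - 1 := by
    obtain ⟨z, hz, h1⟩ := exists_d t
    obtain ⟨w, hw, h2⟩ := exists_d (t + 1)
    have h3 := d_le t w hw
    have h4 := d_le (t + 1) z hz
    obtain ⟨z', rfl⟩ := h_even z hz
    obtain ⟨w', rfl⟩ := h_even w hw
    push_cast at *
    omega
  have d_end : d (2 * n) = 0 := by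
    have := d_le (2 * n) (2 * n) h_end
    have := d_nonneg (2 * n)
    omega
  refine ⟨⟨fun t => if 2 * n ≤ t then 0 else d t, ?_, ?_, ?_, ?_⟩, ?_, ?_⟩
  · have := d_le 0 0 h_zero
    have := d_nonneg 0
    split_ifs <;> omega
  · intro t ht
    simp [ht]
  · intro t ht
    have := d_step t
    rcases Nat.lt_or_ge (t + 1) (2 * n) with h | h
    · rwa [if_neg (by omega), if_neg (by omega)]
    · rw [show t + 1 = 2 * n by omega, d_end] at this
      rwa [if_pos h, if_neg (by omega)]
  · intro t
    have := d_nonneg t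
    split_ifs <;> omega
  · intro t ht
    simpa [not_le.2 ht] using exists_d t
  · intro t z hz
    have := d_le t z hz
    dsimp only
    split_ifs <;> omega

/-- A Dyck path all of whose factors are pyramids is determined by its zeros. -/
theorem eq_of_factorsArePyramids {P Q : DyckPath n} (hP : FactorsArePyramids P)
    (hQ : FactorsArePyramids Q) (hPQ : ∀ t ≤ 2 * n, P.h t = 0 ↔ Q.h t = 0) : P = Q := by
  refine ext_height fun t => ?_
  rcases Nat.lt_or_ge t (2 * n) with ht | ht
  · obtain ⟨a, hat, ha, ha_max⟩ :
        ∃ a ≤ t, P.h a = 0 ∧ ∀ c, a < c → c ≤ t → P.h c ≠ 0 :=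
      ⟨_, Nat.findGreatest_le t, Nat.findGreatest_spec (P := fun a => P.h a = 0) t.zero_le P.init,
        fun _ => Nat.findGreatest_is_greatest⟩
    have h_ex : ∃ b, t < b ∧ P.h b = 0 := ⟨2 * n, ht, P.tail _ le_rfl⟩
    obtain ⟨b, ⟨htb, hb⟩, hbn, hb_min⟩ :
        ∃ b, (t < b ∧ P.h b = 0) ∧ b ≤ 2 * n ∧ ∀ c < b, ¬ (t < c ∧ P.h c = 0) :=
      ⟨_, Nat.find_spec h_ex, Nat.find_min' h_ex ⟨ht, P.tail _ le_rfl⟩, fun _ => Nat.find_min h_ex⟩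
    have h_ne (c : ℕ) (hac : a < c) (hcb : c < b) : P.h c ≠ 0 := by
      rcases le_or_gt c t with h | h
      · exact ha_max c hac h
      · exact fun hc => hb_min c hcb ⟨h, hc⟩
    rw [hP a b (by omega) hbn ha hb
        (fun c hac hcb => (P.nonneg c).lt_of_ne' (h_ne c hac hcb)) t hat htb.le,
      hQ a b (by omega) hbn ((hPQ a (by omega)).1 ha) ((hPQ b hbn).1 hb)
        (fun c hac hcb => (Q.nonneg c).lt_of_ne'
          fun hc => h_ne c hac hcb ((hPQ c (by omega)).2 hc)) t hat htb.le]
  · rw [P.tail t ht, Q.tail t ht]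

theorem isReturn_iff {P : DyckPath n} {x : ℕ} (h_even : Even x) (h_pos : 0 < x)
    (h_lt : x < 2 * n) : IsReturn P x ↔ P.h x = 0 := by
  obtain ⟨k, rfl⟩ := h_even
  exact ⟨fun h => h.2.2.2, fun h => ⟨⟨k, rfl⟩, by omega, by omega, h⟩⟩

theorem height_eq_zero_iff_of_isReturn_iff {P Q : DyckPath n}
    (h : ∀ x : ℕ, Even x → 0 < x → x < 2 * n → (IsReturn P x ↔ IsReturn Q x)) {t : ℕ}
    (ht : t ≤ 2 * n) : P.h t = 0 ↔ Q.h t = 0 := by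
  rcases Nat.eq_zero_or_pos t with rfl | h_pos
  · simp [P.init, Q.init]
  rcases ht.eq_or_lt with rfl | h_lt
  · simp [P.tail, Q.tail]
  rcases Nat.even_or_odd t with h_even | ⟨k, rfl⟩
  · rw [← isReturn_iff h_even h_pos h_lt, ← isReturn_iff h_even h_pos h_lt]
    exact h t h_even h_pos h_lt
  · have := P.height_mod_two ht
    have := Q.height_mod_two ht
    omega

/-- Two paths have meet at most `(ud)^n` iff at every even abscissa one of them vanishes. -/
theorem min_height_le_minPath_iff {P S : DyckPath n} :
    (∀ t, min (P.h t) (S.h t) ≤ (minPath n).h t) ↔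
      ∀ x, Even x → x < 2 * n → P.h x ≠ 0 → S.h x = 0 := by
  constructor
  · rintro h x ⟨k, rfl⟩ hx hPx
    have h1 := h (k + k)
    have := P.nonneg (k + k)
    have := S.nonneg (k + k)
    simp only [minPath, minH, if_neg (not_le.2 hx)] at h1
    omega
  · intro h t
    simp only [minPath, minH]
    split_ifs with ht
    · simp [P.tail t ht]
    rw [not_le] at ht
    rcases Nat.even_or_odd t with h_even | ⟨k, rfl⟩
    · have := h t h_even ht
      have := P.nonneg t
      omega
    · have := h (2 * k) (even_two_mul k) (by omega)
      have := P.step (2 * k) (by omega)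
      have := S.step (2 * k) (by omega)
      omega

/-- The height of the pseudocomplement of `P` is the distance to the set of its zeros, namely the
ends and the even abscissae where `P` is positive. -/
theorem exists_height_eq_dist_of_isPseudo {P R : DyckPath n} (hR : IsPseudo P R) :
    ∃ Z : Finset ℕ, (∀ z, z ∈ Z ↔ Even z ∧ z ≤ 2 * n ∧ (z = 0 ∨ z = 2 * n ∨ P.h z ≠ 0)) ∧
      (∀ z ∈ Z, R.h z = 0) ∧
      ∀ t < 2 * n, ∃ z ∈ Z, R.h t = max ((t : ℤ) - z) ((z : ℤ) - t) := by
  let Z := (Finset.range (2 * n + 1)).filter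
    fun z => Even z ∧ (z = 0 ∨ z = 2 * n ∨ P.h z ≠ 0)
  have mem_Z (z : ℕ) : z ∈ Z ↔ Even z ∧ z ≤ 2 * n ∧ (z = 0 ∨ z = 2 * n ∨ P.h z ≠ 0) := by
    simp only [Z, Finset.mem_filter, Finset.mem_range, Nat.lt_succ_iff]
    tauto
  obtain ⟨M, hM, hM_le⟩ := exists_height_eq_dist (n := n) Z (fun z hz => ((mem_Z z).1 hz).1)
    ((mem_Z 0).2 (by simp)) ((mem_Z _).2 (by simp))
  have hMR : dle M R := by
    refine hR.2 M (min_height_le_minPath_iff.2 fun x h_even hx hPx => ?_)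
    have := hM_le x x ((mem_Z x).2 ⟨h_even, hx.le, .inr (.inr hPx)⟩)
    have := M.nonneg x
    omega
  have hRZ (z : ℕ) (hz : z ∈ Z) : R.h z = 0 := by
    obtain ⟨h_even, hzn, rfl | rfl | hPz⟩ := (mem_Z z).1 hz
    · exact R.init
    · exact R.tail _ le_rfl
    · rcases hzn.eq_or_lt with rfl | hzn
      · exact R.tail _ le_rfl
      · exact min_height_le_minPath_iff.1 hR.1 z h_even hzn hPz
  refine ⟨Z, mem_Z, hRZ, fun t ht => ?_⟩
  obtain ⟨z, hz, h⟩ := hM t ht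
  exact ⟨z, hz, le_antisymm (R.height_le_dist_zero (hRZ z hz) t) (h ▸ hMR t)⟩

end DyckPath

open DyckPath

/-- The pseudocomplement `∼P` is the unique Dyck path `Q` of semilength `n` such that
every factor of `Q` is a pyramid and, for every even `x` with `0 < x < 2n`,
`x` is a return of `Q` iff `x` is not a return of `P`. -/
theorem pseudo_unique_characterization (n : ℕ) (P R : DyckPath n) (hR : IsPseudo P R) :
    FactorsArePyramids R ∧
    (∀ x : ℕ, Even x → 0 < x → x < 2 * n → (IsReturn R x ↔ ¬ IsReturn P x)) ∧
    ∀ Q : DyckPath n, FactorsArePyramids Q →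
      (∀ x : ℕ, Even x → 0 < x → x < 2 * n → (IsReturn Q x ↔ ¬ IsReturn P x)) →
      Q = R := by
  obtain ⟨Z, mem_Z, hRZ, hR_dist⟩ := exists_height_eq_dist_of_isPseudo hR
  have h_pyr : FactorsArePyramids R := by
    intro a b hab hbn ha hb h_pos t hat htb
    have h1 := R.height_le_dist_zero ha t
    have h2 := R.height_le_dist_zero hb t
    rcases htb.eq_or_lt with rfl | htb
    · omega
    obtain ⟨z, hz, h⟩ := hR_dist t (by omega)
    have : z ≤ a ∨ b ≤ z := by
      by_contra! hz'
      exact (h_pos z hz'.1 hz'.2).ne' (hRZ z hz)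
    omega
  have h_ret (x : ℕ) (h_even : Even x) (h_pos : 0 < x) (h_lt : x < 2 * n) :
      IsReturn R x ↔ ¬ IsReturn P x := by
    rw [isReturn_iff h_even h_pos h_lt, isReturn_iff h_even h_pos h_lt]
    constructor
    · intro hx
      obtain ⟨z, hz, h⟩ := hR_dist x h_lt
      obtain rfl : x = z := by omega
      have := (mem_Z x).1 hz
      omega
    · exact fun hx => hRZ x ((mem_Z x).2 ⟨h_even, h_lt.le, .inr (.inr hx)⟩)
  refine ⟨h_pyr, h_ret, fun Q hQ hQP => eq_of_factorsArePyramids hQ h_pyr fun t ht => ?_⟩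
  exact height_eq_zero_iff_of_isReturn_iff
    (fun x h0 h1 h2 => (hQP x h0 h1 h2).trans (h_ret x h0 h1 h2).symm) ht
end

section
/- A Dyck path P of semilength n is a regular element of the Dyck algebra 𝔇_n (that is, ∼∼P = P) if and only if every factor of P is a pyramid. -/
namespace DyckPath

variable {n : ℕ}

theorem ext_h {P Q : DyckPath n} (hPQ : ∀ t, P.h t = Q.h t) : P = Q := by
  cases P
  cases Q
  congr
  exact funext hPQ

theorem h_emod_two (P : DyckPath n) (t : ℕ) (ht : t ≤ 2 * n) : P.h t % 2 = (t : ℤ) % 2 := by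
  induction t with
  | zero => simp [P.init]
  | succ t ih =>
    have := ih (by omega)
    have := P.step t (by omega)
    omega

theorem h_succ_le (P : DyckPath n) (t : ℕ) :
    P.h (t + 1) ≤ P.h t + 1 ∧ P.h t ≤ P.h (t + 1) + 1 := by
  rcases lt_or_ge t (2 * n) with ht | ht
  · have := P.step t ht
    omega
  · have := P.tail t ht
    have := P.tail (t + 1) (by omega)
    omega

theorem h_le_h_add (P : DyckPath n) (s k : ℕ) :
    P.h (s + k) ≤ P.h s + k ∧ P.h s ≤ P.h (s + k) + k := by
  induction k with
  | zero => simp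
  | succ k ih =>
    have := P.h_succ_le (s + k)
    rw [← add_assoc]
    push_cast
    omega

/-- The meet of two Dyck paths is the minimum path iff they have no common positive height at an
even abscissa. -/
theorem min_le_minPath_iff (P S : DyckPath n) :
    (∀ t, min (P.h t) (S.h t) ≤ (minPath n).h t) ↔
      ∀ t, Even t → P.h t = 0 ∨ S.h t = 0 := by
  constructor
  · intro H t ht
    have h0 := H t
    have := P.nonneg t
    have := S.nonneg t
    simp only [minPath, minH] at h0
    obtain ⟨k, rfl⟩ := ht
    split_ifs at h0 <;> omega
  · intro H t
    simp only [minPath, minH]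
    split_ifs with ht
    · have := P.tail t ht
      omega
    · rcases Nat.even_or_odd t with he | ⟨k, rfl⟩
      · have := H t he
        have := P.nonneg t
        omega
      · have := H (2 * k) (by simp)
        have := P.h_succ_le (2 * k)
        have := S.h_succ_le (2 * k)
        push_cast
        omega

/-- The path obtained from `Q` by replacing its part between two zeros by a pyramid. -/
def pyramidBetween (Q : DyckPath n) (a b : ℕ) (hb : b ≤ 2 * n)
    (ha0 : Q.h a = 0) (hb0 : Q.h b = 0) : DyckPath n where
  h t := if a < t ∧ t < b then min ((t : ℤ) - a) ((b : ℤ) - t) else Q.h t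
  init := by simp [Q.init]
  tail t ht := by
    rw [if_neg (by omega)]
    exact Q.tail t ht
  step t ht := by
    have hs := Q.step t ht
    by_cases hab : a ≤ t ∧ t < b
    · have hpa := Q.h_emod_two a (by omega)
      have hpb := Q.h_emod_two b hb
      have h1 : (if a < t ∧ t < b then min ((t : ℤ) - a) ((b : ℤ) - t) else Q.h t)
          = min ((t : ℤ) - a) ((b : ℤ) - t) := by
        split_ifs with h
        · rfl
        · obtain rfl : a = t := by omega
          omega
      have h2 : (if a < t + 1 ∧ t + 1 < b then min (((t + 1 : ℕ) : ℤ) - a) ((b : ℤ) - (t + 1 : ℕ))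
          else Q.h (t + 1)) = min (((t + 1 : ℕ) : ℤ) - a) ((b : ℤ) - (t + 1 : ℕ)) := by
        split_ifs with h
        · rfl
        · obtain rfl : b = t + 1 := by omega
          omega
      rw [h1, h2]
      push_cast
      omega
    · rw [if_neg (by omega), if_neg (by omega)]
      exact hs
  nonneg t := by
    have := Q.nonneg t
    split_ifs <;> omega

/-- The path obtained from `Q` by turning the valley at an interior zero into a peak. -/
def raiseZero (Q : DyckPath n) (x : ℕ) (hx : 0 < x) (hx0 : Q.h x = 0) (hxn : x < 2 * n) :
    DyckPath n where
  h t := if t = x then 2 else Q.h t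
  init := by rw [if_neg (by omega), Q.init]
  tail t ht := by rw [if_neg (by omega), Q.tail t ht]
  step t ht := by
    have hs := Q.step t ht
    have := Q.nonneg t
    have := Q.nonneg (t + 1)
    by_cases h1 : t = x
    · subst h1
      simp
      omega
    · by_cases h2 : t + 1 = x
      · subst h2
        simp
        omega
      · simpa [h1, h2] using hs
  nonneg t := by
    have := Q.nonneg t
    split_ifs <;> omega

theorem exists_last_zero (P : DyckPath n) (t : ℕ) :
    ∃ a ≤ t, P.h a = 0 ∧ ∀ c, a < c → c ≤ t → 0 < P.h c := by
  induction t with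
  | zero => exact ⟨0, le_rfl, P.init, by omega⟩
  | succ t ih =>
    by_cases h0 : P.h (t + 1) = 0
    · exact ⟨t + 1, le_rfl, h0, by omega⟩
    · obtain ⟨a, hat, ha, H⟩ := ih
      refine ⟨a, by omega, ha, fun c hac hct ↦ ?_⟩
      rcases Nat.lt_or_ge t c with hc | hc
      · obtain rfl : c = t + 1 := by omega
        have := P.nonneg (t + 1)
        omega
      · exact H c hac hc

theorem exists_next_zero (P : DyckPath n) (t : ℕ) (ht : t ≤ 2 * n) :
    ∃ b, t ≤ b ∧ b ≤ 2 * n ∧ P.h b = 0 ∧ ∀ c, t ≤ c → c < b → 0 < P.h c := by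
  classical
  have hex : ∃ b, t ≤ b ∧ P.h b = 0 := ⟨2 * n, ht, P.tail _ le_rfl⟩
  refine ⟨Nat.find hex, (Nat.find_spec hex).1, Nat.find_min' hex ⟨ht, P.tail _ le_rfl⟩,
    (Nat.find_spec hex).2, fun c htc hc ↦ ?_⟩
  have := Nat.find_min hex hc
  have := P.nonneg c
  omega

end DyckPath

theorem FactorsArePyramids.eq_of_zeros {n : ℕ} {P R : DyckPath n} (hP : FactorsArePyramids P)
    (hR : FactorsArePyramids R) (hz : ∀ t, P.h t = 0 ↔ R.h t = 0) : P = R := by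
  refine DyckPath.ext_h fun t ↦ ?_
  rcases Nat.lt_or_ge (2 * n) t with ht | ht
  · rw [P.tail t ht.le, R.tail t ht.le]
  by_cases h0 : P.h t = 0
  · rw [h0, (hz t).1 h0]
  obtain ⟨a, hat, ha, Ha⟩ := P.exists_last_zero t
  obtain ⟨b, htb, hbn, hb, Hb⟩ := P.exists_next_zero t ht
  have hat' : a ≠ t := fun h ↦ h0 (h ▸ ha)
  have hpos : ∀ c, a < c → c < b → 0 < P.h c := fun c hac hcb ↦
    (le_total c t).elim (Ha c hac) (fun h ↦ Hb c h hcb)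
  rw [hP a b (by omega) hbn ha hb hpos t hat htb,
    hR a b (by omega) hbn ((hz a).1 ha) ((hz b).1 hb) (fun c hac hcb ↦
      lt_of_le_of_ne (R.nonneg c) fun h ↦ (hpos c hac hcb).ne' ((hz c).2 h.symm)) t hat htb]

theorem IsPseudo.factorsArePyramids {n : ℕ} {P Q : DyckPath n} (hQ : IsPseudo P Q) :
    FactorsArePyramids Q := by
  obtain ⟨hle, hmax⟩ := hQ
  rw [DyckPath.min_le_minPath_iff] at hle
  intro a b hab hbn ha hb hpos t hat htb
  have hS := hmax (Q.pyramidBetween a b hbn ha hb) (by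
    rw [DyckPath.min_le_minPath_iff]
    intro s hs
    by_cases h : a < s ∧ s < b
    · exact Or.inl ((hle s hs).resolve_right (hpos s h.1 h.2).ne')
    · simpa [DyckPath.pyramidBetween, h] using hle s hs) t
  have h1 := (Q.h_le_h_add a (t - a)).1
  have h2 := (Q.h_le_h_add t (b - t)).2
  rw [Nat.add_sub_cancel' hat] at h1
  rw [Nat.add_sub_cancel' htb] at h2
  push_cast [hat, htb] at h1 h2
  have := Q.nonneg t
  simp only [DyckPath.pyramidBetween] at hS
  split_ifs at hS <;> omega

theorem IsPseudo.h_eq_zero_iff {n : ℕ} {P Q : DyckPath n} (hQ : IsPseudo P Q) {t : ℕ}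
    (he : Even t) (h0 : 0 < t) (hn : t < 2 * n) : Q.h t = 0 ↔ P.h t ≠ 0 := by
  obtain ⟨hle, hmax⟩ := hQ
  rw [DyckPath.min_le_minPath_iff] at hle
  refine ⟨fun hq hp ↦ ?_, (hle t he).resolve_left⟩
  have hS := hmax (Q.raiseZero t h0 hq hn) (by
    rw [DyckPath.min_le_minPath_iff]
    intro s hs
    by_cases h : s = t
    · exact Or.inl (h ▸ hp)
    · simpa [DyckPath.raiseZero, h] using hle s hs) t
  simp [DyckPath.raiseZero, hq] at hS

theorem IsPseudo.h_eq_zero_iff_of_isPseudo {n : ℕ} {P Q R : DyckPath n} (hQ : IsPseudo P Q)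
    (hR : IsPseudo Q R) (t : ℕ) : R.h t = 0 ↔ P.h t = 0 := by
  rcases Nat.eq_zero_or_pos t with rfl | h0
  · simp [P.init, R.init]
  rcases Nat.lt_or_ge t (2 * n) with hn | hn
  · rcases Nat.even_or_odd t with he | ⟨k, rfl⟩
    · rw [hR.h_eq_zero_iff he h0 hn, Ne, hQ.h_eq_zero_iff he h0 hn, not_not]
    · have := P.h_emod_two _ hn.le
      have := R.h_emod_two _ hn.le
      omega
  · simp [P.tail t hn, R.tail t hn]

/-- A Dyck path `P` of semilength `n` is a regular element of the Dyck algebra `𝔇_n`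
(that is, `∼∼P = P`) if and only if every factor of `P` is a pyramid. -/
theorem regular_iff_factors_pyramids (n : ℕ) (P Q R : DyckPath n)
    (h1 : IsPseudo P Q) (h2 : IsPseudo Q R) :
    R = P ↔ FactorsArePyramids P := by
  constructor
  · rintro rfl
    exact h2.factorsArePyramids
  · intro hP
    exact h2.factorsArePyramids.eq_of_zeros hP (h1.h_eq_zero_iff_of_isPseudo h2)
end

section
/- For every φ ∈ Θ_n there exists a unique antichain (with respect to set inclusion) {I_1, ..., I_r} (r ≥ 0) of intervals of [n] = {1,...,n} such that φ is semantically equivalent to ε_{I_1} ∨ ε_{I_2} ∨ ... ∨ ε_{I_r}, i.e., φ(I) = (ε_{I_1} ∨ ... ∨ ε_{I_r})(I) for every interval I of T_n, where the empty disjunction is ⊥. (This expression is the closed disjunctive form of φ.) -/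
/-- Formulas of the interval temporal logic `ITL_n`, with propositional variables
`ε_1, …, ε_n` (indexed by `Fin n`), the classical connectives `∨, ∧, →, ¬`,
the pseudonegation `∼` (`snot`) and the pseudoimplication `⇝` (`simp`). -/
inductive ITL (n : ℕ) : Type where
  | bot : ITL n
  | top : ITL n
  | var : Fin n → ITL n
  | or : ITL n → ITL n → ITL n
  | and : ITL n → ITL n → ITL n
  | imp : ITL n → ITL n → ITL n
  | not : ITL n → ITL n
  | snot : ITL n → ITL n
  | simp : ITL n → ITL n → ITL n

/-- An interval `[t_i, t_j]` (with `i ≤ j`) of the chain `T_n = {t_1 < ⋯ < t_n}`,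
encoded by its endpoints in `Fin n`. -/
abbrev Ivl (n : ℕ) : Type := {p : Fin n × Fin n // p.1 ≤ p.2}

/-- `SubIvl J I` means that the interval `J` is a subinterval of `I`. -/
def SubIvl {n : ℕ} (J I : Ivl n) : Prop := I.1.1 ≤ J.1.1 ∧ J.1.2 ≤ I.1.2

/-- The truth value of a formula at an interval: `eval φ I` means `φ(I) = 1`. -/
def eval {n : ℕ} : ITL n → Ivl n → Prop
  | .bot, _ => False
  | .top, _ => True
  | .var i, I => I.1.1 = i ∧ I.1.2 = i
  | .or φ ψ, I => eval φ I ∨ eval ψ I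
  | .and φ ψ, I => eval φ I ∧ eval ψ I
  | .imp φ ψ, I => eval φ I → eval ψ I
  | .not φ, I => ¬ eval φ I
  | .snot φ, I => ∀ J : Ivl n, SubIvl J I → ¬ eval φ J
  | .simp φ ψ, I => ∀ J : Ivl n, SubIvl J I → eval φ J → eval ψ J

/-- `Θ_n`: the set of formulas `φ` such that `φ → □φ` is valid, i.e. whenever
`φ(I) = 1` and `J ⊆ I`, also `φ(J) = 1`. -/
def Theta {n : ℕ} (φ : ITL n) : Prop :=
  ∀ I J : Ivl n, SubIvl J I → eval φ I → eval φ J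

/-- The disjunction `⋁` of a list of formulas (the empty disjunction being `⊥`). -/
def veeList {n : ℕ} : List (ITL n) → ITL n
  | [] => ITL.bot
  | φ :: l => ITL.or φ (veeList l)

/-- For an interval `K` of `[n]`, the formula `ε_K = ∼∼(⋁_{i ∈ K} ε_i)`. -/
def epsI {n : ℕ} (K : Ivl n) : ITL n :=
  ITL.snot (ITL.snot (veeList
    (((List.finRange n).filter (fun i => decide (K.1.1 ≤ i ∧ i ≤ K.1.2))).map ITL.var)))

/-- In a finite partial order, every lower set is generated by a unique antichain. -/
theorem existsUnique_antichain_of_isLowerSet {α : Type*} [PartialOrder α] [Finite α]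
    {p : α → Prop} (hp : ∀ a b, b ≤ a → p a → p b) :
    ∃! S : Finset α, (∀ a ∈ S, ∀ b ∈ S, a ≠ b → ¬ a ≤ b) ∧
      ∀ a, p a ↔ ∃ b ∈ S, a ≤ b := by
  classical
  have := Fintype.ofFinite α
  refine ⟨Finset.univ.filter (Maximal p), ⟨?_, fun a => ⟨fun ha => ?_, ?_⟩⟩, ?_⟩
  · intro a ha b hb hab hle
    simp only [Finset.mem_filter, Finset.mem_univ, true_and] at ha hb
    exact hab (ha.eq_of_le hb.prop hle)
  · obtain ⟨m, ham, hm⟩ := Finite.exists_le_maximal ha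
    exact ⟨m, by simpa using hm, ham⟩
  · rintro ⟨b, hb, hab⟩
    simp only [Finset.mem_filter, Finset.mem_univ, true_and] at hb
    exact hp b a hab hb.prop
  · rintro S ⟨hS, hpS⟩
    ext a
    simp only [Finset.mem_filter, Finset.mem_univ, true_and]
    constructor
    · refine fun ha => ⟨(hpS a).2 ⟨a, ha, le_rfl⟩, fun b hb hab => ?_⟩
      obtain ⟨c, hc, hbc⟩ := (hpS b).1 hb
      have hac : a = c := by_contra fun h => hS a ha c hc h (hab.trans hbc)
      exact hac ▸ hbc
    · intro ha
      obtain ⟨b, hb, hab⟩ := (hpS a).1 ha.prop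
      exact ha.eq_of_le ((hpS b).2 ⟨b, hb, le_rfl⟩) hab ▸ hb

/-- Intervals ordered by inclusion. -/
abbrev subIvlPartialOrder (n : ℕ) : PartialOrder (Ivl n) where
  le := SubIvl
  lt I J := SubIvl I J ∧ ¬ SubIvl J I
  lt_iff_le_not_ge _ _ := Iff.rfl
  le_refl _ := ⟨le_rfl, le_rfl⟩
  le_trans _ _ _ h₁ h₂ := ⟨h₂.1.trans h₁.1, h₁.2.trans h₂.2⟩
  le_antisymm _ _ h₁ h₂ :=
    Subtype.ext (Prod.ext (h₂.1.antisymm h₁.1) (h₁.2.antisymm h₂.2))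

theorem eval_veeList {n : ℕ} (l : List (ITL n)) (I : Ivl n) :
    eval (veeList l) I ↔ ∃ φ ∈ l, eval φ I := by
  induction l with
  | nil => simp [veeList, eval]
  | cons φ l ih => simp [veeList, eval, ih]

theorem eval_snot_snot {n : ℕ} (φ : ITL n) (I : Ivl n) :
    eval (.snot (.snot φ)) I ↔ ∀ J, SubIvl J I → ∃ L, SubIvl L J ∧ eval φ L := by
  simp [eval]

theorem eval_epsI {n : ℕ} (K I : Ivl n) : eval (epsI K) I ↔ SubIvl I K := by
  have hatom (L : Ivl n) : eval (veeList
      (((List.finRange n).filter (fun i => decide (K.1.1 ≤ i ∧ i ≤ K.1.2))).map ITL.var)) L ↔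
      L.1.1 = L.1.2 ∧ SubIvl L K := by
    simp only [eval_veeList, List.mem_map, List.mem_filter, List.mem_finRange, true_and,
      decide_eq_true_eq, exists_exists_and_eq_and, eval, SubIvl]
    grind
  simp only [epsI, eval_snot_snot, hatom]
  constructor
  · intro h
    obtain ⟨L, ⟨h₁, h₂⟩, h₃, h₄, h₅⟩ := h ⟨(I.1.1, I.1.1), le_rfl⟩ ⟨le_rfl, I.2⟩
    obtain ⟨M, ⟨k₁, k₂⟩, k₃, k₄, k₅⟩ := h ⟨(I.1.2, I.1.2), le_rfl⟩ ⟨I.2, le_rfl⟩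
    exact ⟨h₄.trans (h₃.le.trans h₂), k₁.trans (k₃.le.trans k₅)⟩
  · rintro ⟨h₁, h₂⟩ J ⟨k₁, k₂⟩
    exact ⟨⟨(J.1.1, J.1.1), le_rfl⟩, ⟨le_rfl, J.2⟩, rfl, h₁.trans k₁, J.2.trans (k₂.trans h₂)⟩

/-- Closed disjunctive form: for every `φ ∈ Θ_n` there is a unique antichain
(w.r.t. inclusion) `{I_1, …, I_r}` of intervals of `[n]` such that `φ` is semantically
equivalent to `ε_{I_1} ∨ ⋯ ∨ ε_{I_r}` (the empty disjunction being `⊥`); i.e.,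
for every interval `I`, `φ(I) = 1` iff `(ε_K)(I) = 1` for some `K` in the antichain. -/
theorem closed_disjunctive_form (n : ℕ) (φ : ITL n) (hφ : Theta φ) :
    ∃! S : Finset (Ivl n),
      (∀ K ∈ S, ∀ L ∈ S, K ≠ L → ¬ SubIvl K L) ∧
      (∀ I : Ivl n, eval φ I ↔ ∃ K ∈ S, eval (epsI K) I) := by
  simp only [eval_epsI]
  exact @existsUnique_antichain_of_isLowerSet _ (subIvlPartialOrder n) _ (eval φ) hφ
end

section
/- Let P ∈ D_n be a Dyck path with P ≠ (ud)^n. Then the number of peaks of P equals |F_P| + ‖F_{∼P}‖ − |F_{∼P}*|. -/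
/-- The height function of the join-irreducible Dyck path `J_{[a,b]}` of semilength `n`
(`1 ≤ a ≤ b ≤ n−1`): all factors are hills except a single pyramid `u^{b−a+2} d^{b−a+2}`
occupying abscissas `2a−2` through `2b+2`. -/
def heightJ (a b t : ℕ) : ℤ :=
  if 2 * (a : ℤ) - 2 ≤ (t : ℤ) ∧ (t : ℤ) ≤ 2 * (b : ℤ) + 2 then
    min ((t : ℤ) - (2 * (a : ℤ) - 2)) (2 * (b : ℤ) + 2 - (t : ℤ))
  else (t : ℤ) % 2

/-- `J_{[a,b]} ≤ P` in the Dyck lattice: the height of the join-irreducible `J_{[a,b]}`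
is pointwise below the height of `P`. -/
def JIle {n : ℕ} (P : DyckPath n) (a b : ℕ) : Prop :=
  ∀ t, t ≤ 2 * n → heightJ a b t ≤ P.h t

/-- `[a,b]` is an interval of `[n−1] = {1, …, n−1}`. -/
def validIvl (n a b : ℕ) : Prop := 1 ≤ a ∧ a ≤ b ∧ b ≤ n - 1

/-- `F_P`: the antichain of all inclusion-maximal intervals `[a,b] ⊆ [n−1]`
with `J_{[a,b]} ≤ P` (intervals encoded as pairs `(a,b)`). -/
def FP {n : ℕ} (P : DyckPath n) : Set (ℕ × ℕ) :=
  {p | validIvl n p.1 p.2 ∧ JIle P p.1 p.2 ∧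
    ∀ q : ℕ × ℕ, validIvl n q.1 q.2 → JIle P q.1 q.2 →
      Set.Icc p.1 p.2 ⊆ Set.Icc q.1 q.2 → q = p}

/-- `‖F_P‖ = |⋃_{I ∈ F_P} I|`. -/
noncomputable def normFP {n : ℕ} (P : DyckPath n) : ℕ :=
  (⋃ p ∈ FP P, Set.Icc p.1 p.2).ncard

/-- `F_P*`: the set of internal intervals of `F_P`, those containing neither `1` nor `n−1`. -/
def FPstar {n : ℕ} (P : DyckPath n) : Set (ℕ × ℕ) :=
  {p ∈ FP P | 1 ∉ Set.Icc p.1 p.2 ∧ n - 1 ∉ Set.Icc p.1 p.2}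

/-- `P` has a peak with apex at abscissa `t`: the `t`-th letter of `P` is `u` and the
`(t+1)`-st is `d`. -/
def IsPeak {n : ℕ} (P : DyckPath n) (t : ℕ) : Prop :=
  1 ≤ t ∧ t + 1 ≤ 2 * n ∧ P.h t = P.h (t - 1) + 1 ∧ P.h (t + 1) = P.h t - 1

/-- `P` has a hill (peak at height 1, i.e. lying on the `x`-axis) with apex at abscissa `t`. -/
def IsHill {n : ℕ} (P : DyckPath n) (t : ℕ) : Prop :=
  IsPeak P t ∧ P.h (t - 1) = 0

namespace DyckPath

variable {n : ℕ}

theorem parity (P : DyckPath n) : ∀ t, t ≤ 2 * n → (P.h t - t) % 2 = 0 := by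
  intro t
  induction t with
  | zero => intro _; simp [P.init]
  | succ t ih =>
    intro ht
    have := ih (by omega)
    rcases P.step t (by omega) with h | h <;> push_cast <;> omega

theorem abs_height_sub_le (P : DyckPath n) (s d : ℕ) :
    |P.h (s + d) - P.h s| ≤ d := by
  induction d with
  | zero => simp
  | succ d ih =>
    rw [abs_le] at ih ⊢
    push_cast
    rw [← add_assoc]
    by_cases hs : s + d < 2 * n
    · rcases P.step (s + d) hs with h | h <;> omega
    · have h1 := P.tail (s + d) (by omega)
      have h2 := P.tail (s + d + 1) (by omega)
      omega

theorem height_le_add (P : DyckPath n) {s t : ℕ} (h : s ≤ t) :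
    P.h t ≤ P.h s + (t - s) ∧ P.h s ≤ P.h t + (t - s) := by
  obtain ⟨d, rfl⟩ := Nat.exists_eq_add_of_le h
  have := abs_le.1 (P.abs_height_sub_le s d)
  push_cast
  omega

theorem height_le (P : DyckPath n) (t : ℕ) (ht : t ≤ 2 * n) :
    P.h t ≤ t ∧ P.h t ≤ 2 * n - t := by
  have h1 := P.height_le_add (Nat.zero_le t)
  have h2 := P.height_le_add ht
  have := P.init
  have := P.tail (2 * n) le_rfl
  push_cast at *
  omega

/-- `J_{[a,b]} ≤ P` only has to be tested at the apex of the pyramid. -/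
theorem jIle_iff (P : DyckPath n) {a b : ℕ} (hv : validIvl n a b) :
    JIle P a b ↔ (b : ℤ) - a + 2 ≤ P.h (a + b) := by
  obtain ⟨ha, hab, hb⟩ := hv
  constructor
  · intro h
    have := h (a + b) (by omega)
    unfold heightJ at this
    push_cast at this
    split_ifs at this <;> omega
  · intro h t ht
    have hp := P.parity t ht
    have hn := P.nonneg t
    unfold heightJ
    split_ifs
    · rcases le_total t (a + b) with hle | hle
      · have := P.height_le_add hle
        push_cast at this
        omega
      · have := P.height_le_add hle
        push_cast at this
        omega
    · omega

theorem mem_FP_iff (P : DyckPath n) {a b : ℕ} :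
    (a, b) ∈ FP P ↔ validIvl n a b ∧ IsPeak P (a + b) ∧ P.h (a + b) = (b : ℤ) - a + 2 := by
  constructor
  · rintro ⟨hv, hJ, hmax⟩
    simp only at hv hJ hmax
    rw [jIle_iff P hv] at hJ
    have key : ∀ c d : ℕ, c ≤ a → b ≤ d → validIvl n c d →
        (d : ℤ) - c + 2 ≤ P.h (c + d) → c = a ∧ d = b := by
      intro c d hc hd hcd hh
      have := hmax (c, d) hcd ((jIle_iff P hcd).2 hh) (Set.Icc_subset_Icc hc hd)
      simpa using this
    obtain ⟨ha, hab, hb⟩ := id hv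
    have hp := P.parity (a + b) (by omega)
    obtain ⟨l1, l2⟩ := P.height_le (a + b) (by omega)
    push_cast at hp l1 l2
    have hheight : P.h (a + b) = (b : ℤ) - a + 2 := by
      by_contra hne
      have h2 : a - 1 + (b + 1) = a + b := by omega
      have := key (a - 1) (b + 1) (by omega) (by omega) ⟨by omega, by omega, by omega⟩
        (by rw [h2]; push_cast; omega)
      omega
    refine ⟨hv, ⟨by omega, by omega, ?_, ?_⟩, hheight⟩
    · have hs := P.step (a + b - 1) (by omega)
      have h2 : a + b - 1 + 1 = a + b := by omega
      rw [h2] at hs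
      rcases hs with hs | hs
      · exact hs
      · have h3 : a - 1 + b = a + b - 1 := by omega
        have := (P.height_le (a + b - 1) (by omega)).1
        have := key (a - 1) b (by omega) le_rfl ⟨by omega, by omega, by omega⟩
          (by rw [h3]; omega)
        omega
    · rcases P.step (a + b) (by omega) with hs | hs
      · have := (P.height_le (a + b + 1) (by omega)).2
        have := key a (b + 1) le_rfl (by omega) ⟨by omega, by omega, by omega⟩
          (by rw [← add_assoc]; push_cast; omega)
        omega
      · exact hs
  · rintro ⟨hv, ⟨h1, h2, h3, h4⟩, hh⟩
    refine ⟨hv, (jIle_iff P hv).2 hh.ge, ?_⟩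
    rintro ⟨c, d⟩ hcd hJ hsub
    rw [jIle_iff P hcd] at hJ
    obtain ⟨ha, hab, hb⟩ := hv
    obtain ⟨hc, hcd, hd⟩ := hcd
    simp only at *
    rw [Set.Icc_subset_Icc_iff hab] at hsub
    have : c = a ∧ d = b := by
      rcases lt_trichotomy (a + b) (c + d) with hlt | heq | hgt
      · have := P.height_le_add (show a + b + 1 ≤ c + d by omega)
        push_cast at this
        omega
      · rw [← heq] at hJ
        omega
      · have := P.height_le_add (show c + d ≤ a + b - 1 by omega)
        push_cast [Nat.cast_sub h1] at this
        omega
    simpa using this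

theorem ncard_FP (P : DyckPath n) :
    (FP P).ncard = {t | IsPeak P t ∧ ¬ IsHill P t}.ncard := by
  refine Set.ncard_congr (fun p _ => p.1 + p.2) ?_ ?_ ?_
  · rintro ⟨a, b⟩ h
    obtain ⟨⟨ha, hab, hb⟩, hp, hh⟩ := (mem_FP_iff P).1 h
    refine ⟨hp, fun hhill => ?_⟩
    have h1 := hhill.2
    have h2 := hp.2.2.1
    dsimp only at h1
    omega
  · rintro ⟨a, b⟩ ⟨c, d⟩ h h' heq
    obtain ⟨⟨ha, hab, hb⟩, hp, hh⟩ := (mem_FP_iff P).1 h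
    obtain ⟨⟨hc, hcd, hd⟩, hp', hh'⟩ := (mem_FP_iff P).1 h'
    dsimp only at heq
    rw [heq] at hh
    have : a = c ∧ b = d := by omega
    simpa using this
  · rintro t ⟨hp, hnh⟩
    obtain ⟨h1, h2, h3, h4⟩ := id hp
    have hpos : P.h (t - 1) ≠ 0 := fun h => hnh ⟨hp, h⟩
    have hnn := P.nonneg (t - 1)
    have hpar := P.parity t (by omega)
    obtain ⟨l1, l2⟩ := P.height_le t (by omega)
    obtain ⟨a, ha⟩ : ∃ a : ℕ, (a : ℤ) = (t - P.h t) / 2 + 1 :=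
      ⟨((t - P.h t) / 2 + 1).toNat, by omega⟩
    obtain ⟨b, hb⟩ : ∃ b : ℕ, (b : ℤ) = (t + P.h t) / 2 - 1 :=
      ⟨((t + P.h t) / 2 - 1).toNat, by omega⟩
    have hab : a + b = t := by omega
    refine ⟨(a, b), (mem_FP_iff P).2 ⟨⟨by omega, by omega, by omega⟩, ?_, ?_⟩, hab⟩
    · rwa [hab]
    · rw [hab]
      omega

/-- The join-irreducible Dyck path `J_{[a,b]}`. -/
def joinIrred {a b : ℕ} (hv : validIvl n a b) : DyckPath n where
  h t := if 2 * n ≤ t then 0 else heightJ a b t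
  init := by
    obtain ⟨ha, hab, hb⟩ := hv
    unfold heightJ
    split_ifs <;> omega
  tail t ht := by simp [ht]
  step t ht := by
    obtain ⟨ha, hab, hb⟩ := hv
    unfold heightJ
    split_ifs <;> push_cast at * <;> omega
  nonneg t := by
    obtain ⟨ha, hab, hb⟩ := hv
    unfold heightJ
    split_ifs <;> omega

theorem exists_height_pos {P : DyckPath n} (hP : P ≠ minPath n) :
    ∃ k, 1 ≤ k ∧ k ≤ n - 1 ∧ P.h (2 * k) ≠ 0 := by
  by_contra! hcon
  have heven : ∀ k, P.h (2 * k) = 0 := by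
    intro k
    rcases Nat.eq_zero_or_pos k with rfl | hk
    · exact P.init
    · by_cases hkn : k ≤ n - 1
      · exact hcon k hk hkn
      · exact P.tail _ (by omega)
  apply hP
  have hh : P.h = (minPath n).h := by
    funext t
    change P.h t = minH n t
    unfold minH
    split_ifs with ht
    · exact P.tail t ht
    · obtain ⟨k, rfl | rfl⟩ := Nat.even_or_odd' t
      · rw [heven]
        omega
      · have h1 := heven k
        have h2 := P.nonneg (2 * k + 1)
        have := P.step (2 * k) (by omega)
        push_cast
        omega
  cases P
  cases hh
  rfl

end DyckPath

namespace IsPseudo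

variable {n : ℕ} {P R : DyckPath n}

/-- `J_{[a,b]} ≤ ∼P` iff `P` touches the axis at all `2i` with `i ∈ [a,b]`. -/
theorem jIle_iff (hR : IsPseudo P R) {a b : ℕ} (hv : validIvl n a b) :
    JIle R a b ↔ ∀ i, a ≤ i → i ≤ b → P.h (2 * i) = 0 := by
  obtain ⟨hmin, hmax⟩ := hR
  constructor
  · obtain ⟨ha, hab, hb⟩ := hv
    intro hJ i hai hib
    have h1 := hJ (2 * i) (by omega)
    have h2 := hmin (2 * i)
    have h3 := P.nonneg (2 * i)
    have h4 : (minPath n).h (2 * i) = 0 := by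
      change minH n (2 * i) = 0
      unfold minH
      split_ifs <;> omega
    unfold heightJ at h1
    push_cast at h1
    split_ifs at h1 <;> omega
  · intro hz t ht
    have hle : dle (DyckPath.joinIrred hv) R := by
      apply hmax
      intro t
      change min (P.h t) (if 2 * n ≤ t then 0 else heightJ a b t) ≤ minH n t
      obtain ⟨ha, hab, hb⟩ := hv
      unfold minH
      by_cases htn : 2 * n ≤ t
      · simp [htn]
      · simp only [htn, if_false]
        unfold heightJ
        split_ifs with hin
        · obtain ⟨k, rfl | rfl⟩ := Nat.even_or_odd' t
          · by_cases hk : a ≤ k ∧ k ≤ b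
            · have := hz k hk.1 hk.2
              omega
            · omega
          · by_cases hk : a ≤ k
            · by_cases hkb : k ≤ b
              · have h0 := hz k hk hkb
                have := P.height_le_add (show 2 * k ≤ 2 * k + 1 by omega)
                push_cast at *
                omega
              · omega
            · have h0 := hz (k + 1) (by omega) (by omega)
              have := P.height_le_add (show 2 * k + 1 ≤ 2 * (k + 1) by omega)
              push_cast at *
              omega
        · exact min_le_right _ _
    have h1 := hle t
    change (if 2 * n ≤ t then 0 else heightJ a b t) ≤ R.h t at h1
    obtain ⟨ha, hab, hb⟩ := hv
    split_ifs at h1 with htn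
    · have h2 : heightJ a b t = 0 := by
        unfold heightJ
        split_ifs <;> omega
      omega
    · exact h1

/-- The maximal intervals of `∼P` are the maximal runs of interior returns of `P`. -/
theorem mem_FP_iff (hR : IsPseudo P R) {a b : ℕ} :
    (a, b) ∈ FP R ↔ validIvl n a b ∧ (∀ i, a ≤ i → i ≤ b → P.h (2 * i) = 0) ∧
      (a = 1 ∨ P.h (2 * (a - 1)) ≠ 0) ∧ (b = n - 1 ∨ P.h (2 * (b + 1)) ≠ 0) := by
  constructor
  · rintro ⟨hv, hJ, hmax⟩
    simp only at hv hJ hmax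
    rw [hR.jIle_iff hv] at hJ
    have key : ∀ c d : ℕ, c ≤ a → b ≤ d → validIvl n c d →
        (∀ i, c ≤ i → i ≤ d → P.h (2 * i) = 0) → c = a ∧ d = b := by
      intro c d hc hd hcd hh
      have := hmax (c, d) hcd ((hR.jIle_iff hcd).2 hh) (Set.Icc_subset_Icc hc hd)
      simpa using this
    obtain ⟨ha, hab, hb⟩ := id hv
    refine ⟨hv, hJ, ?_, ?_⟩
    · by_contra! hcon
      have := key (a - 1) b (by omega) le_rfl ⟨by omega, by omega, hb⟩ (by
        intro i h1 h2
        rcases Nat.lt_or_ge i a with h | h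
        · obtain rfl : i = a - 1 := by omega
          exact hcon.2
        · exact hJ i h h2)
      omega
    · by_contra! hcon
      have := key a (b + 1) le_rfl (by omega) ⟨ha, by omega, by omega⟩ (by
        intro i h1 h2
        rcases Nat.lt_or_ge b i with h | h
        · obtain rfl : i = b + 1 := by omega
          exact hcon.2
        · exact hJ i h1 h)
      omega
  · rintro ⟨hv, hz, hl, hr⟩
    refine ⟨hv, (hR.jIle_iff hv).2 hz, ?_⟩
    rintro ⟨c, d⟩ hcd hJ hsub
    rw [hR.jIle_iff hcd] at hJ
    obtain ⟨ha, hab, hb⟩ := hv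
    obtain ⟨hc, hcd, hd⟩ := hcd
    simp only at *
    rw [Set.Icc_subset_Icc_iff hab] at hsub
    have h1 : c = a := by
      by_contra hne
      rcases hl with hl | hl
      · omega
      · exact hl (hJ _ (by omega) (by omega))
    have h2 : d = b := by
      by_contra hne
      rcases hr with hr | hr
      · omega
      · exact hr (hJ _ (by omega) (by omega))
    rw [h1, h2]

end IsPseudo

/-- A run of `p` downwards from `j` extends to one that is maximal among those above `1`. -/
theorem exists_maximal_run_left (p : ℕ → Prop) {j : ℕ} (hj : 1 ≤ j) (hp : p j) :
    ∃ a, 1 ≤ a ∧ a ≤ j ∧ (∀ i, a ≤ i → i ≤ j → p i) ∧ (a = 1 ∨ ¬ p (a - 1)) := by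
  induction j, hj using Nat.le_induction with
  | base => exact ⟨1, le_rfl, le_rfl, fun i h1 h2 => le_antisymm h2 h1 ▸ hp, Or.inl rfl⟩
  | succ j hj ih =>
    by_cases hpj : p j
    · obtain ⟨a, h1, h2, h3, h4⟩ := ih hpj
      refine ⟨a, h1, by omega, fun i hi hi' => ?_, h4⟩
      rcases Nat.lt_or_ge j i with h | h
      · obtain rfl : i = j + 1 := by omega
        exact hp
      · exact h3 i hi h
    · exact ⟨j + 1, by omega, le_rfl, fun i h1 h2 => le_antisymm h2 h1 ▸ hp, Or.inr hpj⟩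

/-- A run of `p` upwards from `j` extends to one that is maximal among those below `m`. -/
theorem exists_maximal_run_right (p : ℕ → Prop) {j m : ℕ} (hj : j ≤ m) (hp : p j) :
    ∃ b, j ≤ b ∧ b ≤ m ∧ (∀ i, j ≤ i → i ≤ b → p i) ∧ (b = m ∨ ¬ p (b + 1)) := by
  induction hj using Nat.decreasingInduction with
  | self => exact ⟨m, le_rfl, le_rfl, fun i h1 h2 => le_antisymm h2 h1 ▸ hp, Or.inl rfl⟩
  | of_succ j hj ih =>
    by_cases hpj : p (j + 1)
    · obtain ⟨b, h1, h2, h3, h4⟩ := ih hpj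
      refine ⟨b, by omega, h2, fun i hi hi' => ?_, h4⟩
      rcases Nat.lt_or_ge j i with h | h
      · exact h3 i h hi'
      · obtain rfl : i = j := by omega
        exact hp
    · exact ⟨j, le_rfl, by omega, fun i h1 h2 => le_antisymm h2 h1 ▸ hp, Or.inr hpj⟩

/-- The set of `i ∈ [n-1]` such that `P` touches the axis at abscissa `2i`. -/
def interiorReturns {n : ℕ} (P : DyckPath n) : Set ℕ :=
  {i | 1 ≤ i ∧ i ≤ n - 1 ∧ P.h (2 * i) = 0}

theorem interiorReturns_finite {n : ℕ} (P : DyckPath n) : (interiorReturns P).Finite :=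
  (Set.finite_Iic (n - 1)).subset fun _ h => h.2.1

namespace IsPseudo

variable {n : ℕ} {P R : DyckPath n}

theorem iUnion_FP (hR : IsPseudo P R) :
    (⋃ p ∈ FP R, Set.Icc p.1 p.2) = interiorReturns P := by
  ext j
  simp only [Set.mem_iUnion, Set.mem_Icc, exists_prop, Prod.exists]
  constructor
  · rintro ⟨a, b, h, h1, h2⟩
    obtain ⟨⟨ha, hab, hb⟩, hz, -⟩ := hR.mem_FP_iff.1 h
    exact ⟨by omega, by omega, hz j h1 h2⟩
  · rintro ⟨h1, h2, h3⟩
    obtain ⟨a, ha, haj, haz, hal⟩ := exists_maximal_run_left (fun i => P.h (2 * i) = 0) h1 h3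
    obtain ⟨b, hjb, hb, hbz, hbr⟩ := exists_maximal_run_right (fun i => P.h (2 * i) = 0) h2 h3
    refine ⟨a, b, hR.mem_FP_iff.2 ⟨⟨ha, by omega, hb⟩, fun i hi hi' => ?_, hal, hbr⟩, haj, hjb⟩
    rcases le_total i j with h | h
    · exact haz i hi h
    · exact hbz i h hi'

/-- Internal maximal intervals of `∼P`, counted by their endpoint farther from a fixed `k`
such that `P` does not touch the axis at `2k`. -/
theorem ncard_FPstar (hR : IsPseudo P R) {k : ℕ} (hk1 : 1 ≤ k) (hkn : k ≤ n - 1)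
    (hk : P.h (2 * k) ≠ 0) :
    (FPstar R).ncard = {j ∈ interiorReturns P |
      (j < k ∧ P.h (2 * (j - 1)) ≠ 0) ∨ (k < j ∧ P.h (2 * (j + 1)) ≠ 0)}.ncard := by
  have side : ∀ {a b : ℕ}, (a, b) ∈ FP R → b < k ∨ k < a := by
    intro a b h
    obtain ⟨-, hz, -⟩ := hR.mem_FP_iff.1 h
    by_contra hcon
    exact hk (hz k (by omega) (by omega))
  have uniq : ∀ {a b c d j : ℕ}, (a, b) ∈ FP R → (c, d) ∈ FP R →
      a ≤ j → j ≤ b → c ≤ j → j ≤ d → (a, b) = (c, d) := by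
    intro a b c d j h h' h1 h2 h3 h4
    obtain ⟨⟨ha, hab, hb⟩, hz, hl, hr⟩ := hR.mem_FP_iff.1 h
    obtain ⟨⟨hc, hcd, hd⟩, hz', hl', hr'⟩ := hR.mem_FP_iff.1 h'
    have e1 : a = c := by
      rcases lt_trichotomy a c with hlt | heq | hgt
      · exact absurd (hz (c - 1) (by omega) (by omega)) (hl'.resolve_left (by omega))
      · exact heq
      · exact absurd (hz' (a - 1) (by omega) (by omega)) (hl.resolve_left (by omega))
    have e2 : b = d := by
      rcases lt_trichotomy b d with hlt | heq | hgt
      · exact absurd (hz' (b + 1) (by omega) (by omega)) (hr.resolve_left (by omega))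
      · exact heq
      · exact absurd (hz (d + 1) (by omega) (by omega)) (hr'.resolve_left (by omega))
    rw [e1, e2]
  refine Set.ncard_congr (fun p _ => if p.2 < k then p.1 else p.2) ?_ ?_ ?_
  · rintro ⟨a, b⟩ ⟨h, h1, hn⟩
    obtain ⟨⟨ha, hab, hb⟩, hz, hl, hr⟩ := hR.mem_FP_iff.1 h
    simp only [Set.mem_Icc] at h1 hn
    have hs := side h
    by_cases hbk : b < k
    · simp only [hbk, if_true]
      exact ⟨⟨ha, by omega, hz a le_rfl hab⟩,
        Or.inl ⟨by omega, hl.resolve_left (by omega)⟩⟩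
    · simp only [hbk, if_false]
      exact ⟨⟨by omega, hb, hz b hab le_rfl⟩,
        Or.inr ⟨by omega, hr.resolve_left (by omega)⟩⟩
  · rintro ⟨a, b⟩ ⟨c, d⟩ ⟨h, -⟩ ⟨h', -⟩ heq
    have hab := (hR.mem_FP_iff.1 h).1.2.1
    have hcd := (hR.mem_FP_iff.1 h').1.2.1
    dsimp only at heq
    have hs := side h
    have hs' := side h'
    refine uniq (j := if b < k then a else b) h h' ?_ ?_ ?_ ?_ <;> split_ifs at * <;> omega
  · rintro j ⟨hj, hj'⟩
    have hmem := hj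
    rw [← hR.iUnion_FP] at hmem
    simp only [Set.mem_iUnion, Set.mem_Icc, exists_prop, Prod.exists] at hmem
    obtain ⟨a, b, h, h1, h2⟩ := hmem
    obtain ⟨⟨ha, hab, hb⟩, hz, hl, hr⟩ := hR.mem_FP_iff.1 h
    have hs := side h
    refine ⟨(a, b), ⟨h, ?_⟩, ?_⟩ <;> simp only [Set.mem_Icc]
    · rcases hj' with ⟨hlt, hne⟩ | ⟨hlt, hne⟩
      · have : a ≠ 1 := by
          rintro rfl
          rcases Nat.eq_or_lt_of_le h1 with rfl | h1
          · exact hne P.init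
          · exact hne (hz _ (by omega) (by omega))
        omega
      · have : b ≠ n - 1 := by
          rintro rfl
          rcases Nat.eq_or_lt_of_le h2 with rfl | h2
          · exact hne (P.tail _ (by omega))
          · exact hne (hz _ (by omega) (by omega))
        omega
    · rcases hj' with ⟨hlt, hne⟩ | ⟨hlt, hne⟩
      · have : ¬ a < j := fun h => hne (hz _ (by omega) (by omega))
        rw [if_pos (by omega)]
        omega
      · have : ¬ j < b := fun h => hne (hz _ (by omega) (by omega))
        rw [if_neg (by omega)]
        omega

end IsPseudo

namespace DyckPath

variable {n : ℕ}

theorem isHill_iff (P : DyckPath n) {t : ℕ} :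
    IsHill P t ↔ ∃ i < n, t = 2 * i + 1 ∧ P.h (2 * i) = 0 ∧ P.h (2 * (i + 1)) = 0 := by
  constructor
  · rintro ⟨⟨h1, h2, h3, h4⟩, h5⟩
    have := P.parity (t - 1) (by omega)
    obtain ⟨i, rfl⟩ : ∃ i, t = 2 * i + 1 := ⟨(t - 1) / 2, by omega⟩
    refine ⟨i, by omega, rfl, h5, ?_⟩
    change P.h (2 * i + 1 + 1) = 0
    rw [h4, h3, h5]
    rfl
  · rintro ⟨i, hi, rfl, h1, h2⟩
    have h3 := P.step (2 * i) (by omega)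
    have h4 := P.nonneg (2 * i + 1)
    have h5 : P.h (2 * i + 1 + 1) = 0 := h2
    have h6 : 2 * i + 1 - 1 = 2 * i := by omega
    refine ⟨⟨by omega, by omega, ?_, ?_⟩, ?_⟩ <;> rw [h6] at * <;> omega

theorem ncard_isHill (P : DyckPath n) {k : ℕ} (hk1 : 1 ≤ k) (hkn : k ≤ n - 1)
    (hk : P.h (2 * k) ≠ 0) :
    {t | IsHill P t}.ncard = {j ∈ interiorReturns P |
      (j < k ∧ P.h (2 * (j - 1)) = 0) ∨ (k < j ∧ P.h (2 * (j + 1)) = 0)}.ncard := by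
  have side : ∀ {i : ℕ}, P.h (2 * i) = 0 → i ≠ k := by
    rintro i h rfl
    exact hk h
  refine Set.ncard_congr (fun t _ => if t < 2 * k then (t + 1) / 2 else (t - 1) / 2) ?_ ?_ ?_
  · intro t ht
    obtain ⟨i, hi, rfl, h1, h2⟩ := P.isHill_iff.1 ht
    have := side h1
    have := side h2
    by_cases hik : 2 * i + 1 < 2 * k
    · have e : (2 * i + 1 + 1) / 2 = i + 1 := by omega
      simp only [hik, if_true, e]
      exact ⟨⟨by omega, by omega, h2⟩, Or.inl ⟨by omega, h1⟩⟩
    · have e : (2 * i + 1 - 1) / 2 = i := by omega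
      simp only [hik, if_false, e]
      exact ⟨⟨by omega, by omega, h1⟩, Or.inr ⟨by omega, h2⟩⟩
  · intro t t' ht ht' heq
    obtain ⟨i, hi, rfl, h1, h2⟩ := P.isHill_iff.1 ht
    obtain ⟨i', hi', rfl, h1', h2'⟩ := P.isHill_iff.1 ht'
    have := side h1
    have := side h2
    have := side h1'
    have := side h2'
    split_ifs at heq <;> omega
  · rintro j ⟨⟨h1, h2, h3⟩, ⟨hlt, h4⟩ | ⟨hlt, h4⟩⟩
    · refine ⟨2 * (j - 1) + 1, P.isHill_iff.2 ⟨j - 1, by omega, rfl, h4, ?_⟩, ?_⟩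
      · rwa [Nat.sub_add_cancel h1]
      · rw [if_pos (by omega)]
        omega
    · refine ⟨2 * j + 1, P.isHill_iff.2 ⟨j, by omega, rfl, h3, h4⟩, ?_⟩
      rw [if_neg (by omega)]
      omega

end DyckPath

/-- The number of hills of `P ≠ (ud)^n` is `‖F_{∼P}‖ − |F_{∼P}*|`. -/
theorem IsPseudo.ncard_isHill_add {n : ℕ} {P R : DyckPath n} (hP : P ≠ minPath n)
    (hR : IsPseudo P R) :
    {t | IsHill P t}.ncard + (FPstar R).ncard = normFP R := by
  obtain ⟨k, hk1, hkn, hk⟩ := DyckPath.exists_height_pos hP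
  have hfin := interiorReturns_finite P
  rw [P.ncard_isHill hk1 hkn hk, hR.ncard_FPstar hk1 hkn hk, normFP, hR.iUnion_FP,
    ← Set.ncard_union_eq _ (hfin.subset (Set.sep_subset _ _)) (hfin.subset (Set.sep_subset _ _))]
  · congr 1
    ext j
    constructor
    · rintro (h | h) <;> exact h.1
    · intro h
      have hjk : j ≠ k := by
        rintro rfl
        exact hk h.2.2
      simp only [Set.mem_union, Set.mem_ofPred_eq, h, true_and]
      by_cases h1 : P.h (2 * (j - 1)) = 0 <;> by_cases h2 : P.h (2 * (j + 1)) = 0 <;>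
        simp only [h1, h2, ne_eq, not_true, not_false_eq_true, and_true, and_false] <;> omega
  · rw [Set.disjoint_left]
    rintro j ⟨-, h⟩ ⟨-, h'⟩
    rcases h with h | h <;> rcases h' with h' | h'
    · exact h'.2 h.2
    · omega
    · omega
    · exact h'.2 h.2

/-- For `P ≠ (ud)^n` with pseudocomplement `∼P = R`, the number of peaks of `P`
equals `|F_P| + ‖F_{∼P}‖ − |F_{∼P}*|`. -/
theorem num_peaks_eq (n : ℕ) (P R : DyckPath n) (hP : P ≠ minPath n) (hR : IsPseudo P R) :
    ({t | IsPeak P t}.ncard : ℤ) =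
      ((FP P).ncard : ℤ) + (normFP R : ℤ) - ((FPstar R).ncard : ℤ) := by
  have hfin : {t | IsPeak P t}.Finite :=
    (Set.finite_Iic (2 * n)).subset fun t h => by
      have := h.2.1
      simp only [Set.mem_Iic]
      omega
  have hsplit : {t | IsPeak P t}.ncard =
      {t | IsHill P t}.ncard + {t | IsPeak P t ∧ ¬ IsHill P t}.ncard := by
    rw [← Set.ncard_union_eq _ (hfin.subset fun t h => h.1) (hfin.subset fun t h => h.1)]
    · congr 1
      ext t
      simp only [Set.mem_union, Set.mem_ofPred_eq]
      exact ⟨fun h => (em (IsHill P t)).imp id fun h' => ⟨h, h'⟩,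
        fun h => h.elim (fun h => h.1) fun h => h.1⟩
    · rw [Set.disjoint_left]
      exact fun t h h' => h'.2 h
  have hhill := hR.ncard_isHill_add hP
  rw [P.ncard_FP]
  omega
end
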